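/- arXiv:2508.06907 — 3 statements merged into one kernel-verified Lean document; each statement's English description precedes it below -/
import Mathlib

section
/- For any m ≥ 2, there exists a square-free permutation r₁r₂…r_{2m-1} of length 2m-1 such that r₂ > r₃ and r_{2m-3} > r_{2m-2}. -/
/-- Two sequences of distinct integers are order-isomorphic:
same length and corresponding pairs compare the same way. -/
def OrdIso (p q : List ℤ) : Prop :=
  p.length = q.length ∧
  ∀ i j : ℕ, i < p.length → j < p.length →
    (p.getD i 0 < p.getD j 0 ↔ q.getD i 0 < q.getD j 0)

/-- A square is a sequence X₁X₂ with X₁ order-isomorphic to X₂ and |X₁| ≥ 2. -/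
def IsSquareL (x : List ℤ) : Prop :=
  ∃ a b : List ℤ, x = a ++ b ∧ 2 ≤ a.length ∧ OrdIso a b

/-- A sequence contains a square if some contiguous factor is a square. -/
def ContainsSquare (p : List ℤ) : Prop :=
  ∃ f : List ℤ, f <:+: p ∧ IsSquareL f

/-- Square-free: no contiguous factor is a square. -/
def SquareFreeL (p : List ℤ) : Prop := ¬ ContainsSquare p

/-- `Q` is an extension of `P` in position `i`:
`Q` has length `|P|+1` and deleting its (i+1)-th symbol gives a
sequence order-isomorphic to `P`. -/
def ExtL (Q P : List ℤ) (i : ℕ) : Prop :=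
  Q.Nodup ∧ Q.length = P.length + 1 ∧ i ≤ P.length ∧ OrdIso (Q.eraseIdx i) P

/-- A sequence whose even-indexed terms repeat its own order pattern, with a peak at each index
`n ≡ 1 [MOD 4]` and a valley at each index `n ≡ 3 [MOD 4]` (from index `1` on). -/
def selfSimilarSeq : ℕ → ℤ
  | 0 => 0
  | n + 1 =>
    if (n + 1) % 2 = 0 then 2 * selfSimilarSeq ((n + 1) / 2)
    else if (n + 1) % 4 = 3 ∨ n = 0 then -((n + 1 : ℕ) : ℤ) ^ 2
    else ((n + 1 : ℕ) : ℤ) ^ 2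
  termination_by n => n
  decreasing_by omega

theorem selfSimilarSeq_two_mul (n : ℕ) : selfSimilarSeq (2 * n) = 2 * selfSimilarSeq n := by
  rcases n with _ | n
  · simp [selfSimilarSeq]
  · rw [show 2 * (n + 1) = (2 * n + 1) + 1 by ring, selfSimilarSeq, if_pos (by omega),
      show (2 * n + 1 + 1) / 2 = n + 1 by omega]

theorem selfSimilarSeq_of_mod_four_eq_three {n : ℕ} (h : n % 4 = 3) :
    selfSimilarSeq n = -(n : ℤ) ^ 2 := by
  rcases n with _ | n
  · omega
  · rw [selfSimilarSeq, if_neg (by omega), if_pos (Or.inl h)]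

theorem selfSimilarSeq_of_mod_four_eq_one {n : ℕ} (h : n % 4 = 1) (hn : n ≠ 1) :
    selfSimilarSeq n = (n : ℤ) ^ 2 := by
  rcases n with _ | n
  · omega
  · rw [selfSimilarSeq, if_neg (by omega), if_neg (by omega)]

theorem selfSimilarSeq_one : selfSimilarSeq 1 = -1 := by
  rw [selfSimilarSeq]; simp

theorem abs_selfSimilarSeq_le (n : ℕ) : |selfSimilarSeq n| ≤ (n : ℤ) ^ 2 := by
  induction n using Nat.strong_induction_on with
  | _ n ih =>
    rcases Nat.even_or_odd' n with ⟨k, rfl | rfl⟩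
    · rcases Nat.eq_zero_or_pos k with rfl | hk
      · simp [selfSimilarSeq]
      · have := ih k (by omega)
        rw [selfSimilarSeq_two_mul, abs_mul, abs_two]
        push_cast
        nlinarith [sq_nonneg (k : ℤ)]
    · by_cases h1 : 2 * k + 1 = 1
      · rw [h1, selfSimilarSeq_one]; simp
      · rcases (by omega : (2 * k + 1) % 4 = 1 ∨ (2 * k + 1) % 4 = 3) with h | h
        · rw [selfSimilarSeq_of_mod_four_eq_one h h1, abs_of_nonneg (by positivity)]
        · rw [selfSimilarSeq_of_mod_four_eq_three h, abs_neg, abs_of_nonneg (by positivity)]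

theorem two_mul_abs_selfSimilarSeq_two_mul_le (n : ℕ) :
    2 * |selfSimilarSeq (2 * n)| ≤ ((2 * n : ℕ) : ℤ) ^ 2 := by
  have := abs_selfSimilarSeq_le n
  rw [selfSimilarSeq_two_mul, abs_mul, abs_two]
  push_cast
  nlinarith

theorem selfSimilarSeq_neighbours_lt {n : ℕ} (h : n % 4 = 1) (hn : n ≠ 1) :
    selfSimilarSeq (n - 1) < selfSimilarSeq n ∧ selfSimilarSeq (n + 1) < selfSimilarSeq n := by
  obtain ⟨j, rfl⟩ : ∃ j, n = 4 * (j + 1) + 1 := ⟨n / 4 - 1, by omega⟩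
  have h1 := two_mul_abs_selfSimilarSeq_two_mul_le (2 * (j + 1))
  have h2 := two_mul_abs_selfSimilarSeq_two_mul_le (2 * (j + 1) + 1)
  rw [selfSimilarSeq_of_mod_four_eq_one h hn,
    show 4 * (j + 1) + 1 - 1 = 2 * (2 * (j + 1)) by omega,
    show 4 * (j + 1) + 1 + 1 = 2 * (2 * (j + 1) + 1) by omega]
  have h3 := le_abs_self (selfSimilarSeq (2 * (2 * (j + 1))))
  have h4 := le_abs_self (selfSimilarSeq (2 * (2 * (j + 1) + 1)))
  push_cast at h1 h2 ⊢
  have hj : (0 : ℤ) ≤ j := Int.natCast_nonneg j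
  constructor <;> nlinarith [sq_nonneg (j : ℤ)]

theorem selfSimilarSeq_lt_neighbours {n : ℕ} (h : n % 4 = 3) :
    selfSimilarSeq n < selfSimilarSeq (n - 1) ∧ selfSimilarSeq n < selfSimilarSeq (n + 1) := by
  obtain ⟨j, rfl⟩ : ∃ j, n = 4 * j + 3 := ⟨n / 4, by omega⟩
  have h1 := two_mul_abs_selfSimilarSeq_two_mul_le (2 * j + 1)
  have h2 := two_mul_abs_selfSimilarSeq_two_mul_le (2 * j + 2)
  rw [selfSimilarSeq_of_mod_four_eq_three h,
    show 4 * j + 3 - 1 = 2 * (2 * j + 1) by omega,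
    show 4 * j + 3 + 1 = 2 * (2 * j + 2) by omega]
  have h3 := neg_abs_le (selfSimilarSeq (2 * (2 * j + 1)))
  have h4 := neg_abs_le (selfSimilarSeq (2 * (2 * j + 2)))
  push_cast at h1 h2 ⊢
  have hj : (0 : ℤ) ≤ j := Int.natCast_nonneg j
  constructor <;> nlinarith [sq_nonneg (j : ℤ)]

theorem selfSimilarSeq_lt_succ_iff {n : ℕ} (hn : 1 ≤ n) :
    selfSimilarSeq n < selfSimilarSeq (n + 1) ↔ n % 4 = 0 ∨ n % 4 = 3 := by
  rcases (by omega : n % 4 = 0 ∨ n % 4 = 1 ∨ n % 4 = 2 ∨ n % 4 = 3) with h | h | h | h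
  · have := (selfSimilarSeq_neighbours_lt (n := n + 1) (by omega) (by omega)).1
    simp_all
  · by_cases h1 : n = 1
    · subst h1
      have := selfSimilarSeq_two_mul 1
      rw [selfSimilarSeq_one] at this
      simp_all [selfSimilarSeq_one]
    · have := (selfSimilarSeq_neighbours_lt h h1).2
      simp [h, this.le]
  · have := (selfSimilarSeq_lt_neighbours (n := n + 1) (by omega)).1
    simp only [Nat.add_sub_cancel] at this
    simp [h, this.le]
  · have := (selfSimilarSeq_lt_neighbours h).2
    simp [h, this]

theorem selfSimilarSeq_succ_lt {n : ℕ} (h : n % 4 = 1 ∨ n % 4 = 2) (hn : n ≠ 1) :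
    selfSimilarSeq (n + 1) < selfSimilarSeq n := by
  rcases h with h | h
  · exact (selfSimilarSeq_neighbours_lt h hn).2
  · exact (selfSimilarSeq_lt_neighbours (n := n + 1) (by omega)).1

theorem selfSimilarSeq_not_square (k : ℕ) (hk : 2 ≤ k) (i : ℕ) (hi : 1 ≤ i) :
    ¬ ∀ x y, x < k → y < k →
      (selfSimilarSeq (i + x) < selfSimilarSeq (i + y) ↔
        selfSimilarSeq (i + k + x) < selfSimilarSeq (i + k + y)) := by
  induction k using Nat.strong_induction_on generalizing i with
  | _ k ih =>
    intro H
    have hsign : ∀ x, x + 1 < k → (((i + x) % 4 = 0 ∨ (i + x) % 4 = 3) ↔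
        ((i + k + x) % 4 = 0 ∨ (i + k + x) % 4 = 3)) := fun x hx => by
      rw [← selfSimilarSeq_lt_succ_iff (by omega), ← selfSimilarSeq_lt_succ_iff (by omega)]
      exact H x (x + 1) (by omega) hx
    have h0 := hsign 0 (by omega)
    have hk4 : k % 4 = 0 := by
      by_cases h2 : k = 2
      · omega
      · have h1 := hsign 1 (by omega)
        omega
    obtain ⟨j, rfl⟩ : ∃ j, k = 4 * j := ⟨k / 4, by omega⟩
    refine ih (2 * j) (by omega) (by omega) ((i + 1) / 2) (by omega) fun x y hx hy => ?_
    have h := H (2 * ((i + 1) / 2 + x) - i) (2 * ((i + 1) / 2 + y) - i) (by omega) (by omega)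
    rw [show i + (2 * ((i + 1) / 2 + x) - i) = 2 * ((i + 1) / 2 + x) by omega,
      show i + (2 * ((i + 1) / 2 + y) - i) = 2 * ((i + 1) / 2 + y) by omega,
      show i + 4 * j + (2 * ((i + 1) / 2 + x) - i) = 2 * ((i + 1) / 2 + 2 * j + x) by omega,
      show i + 4 * j + (2 * ((i + 1) / 2 + y) - i) = 2 * ((i + 1) / 2 + 2 * j + y) by omega]
      at h
    simpa only [selfSimilarSeq_two_mul, mul_lt_mul_iff_right₀ (zero_lt_two' ℤ)] using h

theorem selfSimilarSeq_injective_of_odd {n k : ℕ} (hn : n % 2 = 1) (hk : k % 2 = 1)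
    (h : selfSimilarSeq n = selfSimilarSeq k) : n = k := by
  have hsq : ∀ l : ℕ, l % 2 = 1 → |selfSimilarSeq l| = (l : ℤ) ^ 2 := fun l hl => by
    by_cases h1 : l = 1
    · subst h1; simp [selfSimilarSeq_one]
    · rcases (by omega : l % 4 = 1 ∨ l % 4 = 3) with h | h
      · rw [selfSimilarSeq_of_mod_four_eq_one h h1, abs_of_nonneg (by positivity)]
      · rw [selfSimilarSeq_of_mod_four_eq_three h, abs_neg, abs_of_nonneg (by positivity)]
  have h' := hsq n hn
  rw [h, hsq k hk] at h'
  have : k ^ 2 = n ^ 2 := by exact_mod_cast h'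
  exact (Nat.pow_left_injective two_ne_zero this).symm

theorem selfSimilarSeq_odd {n : ℕ} (hn : n % 2 = 1) : Odd (selfSimilarSeq n) := by
  have hodd : Odd ((n : ℤ) ^ 2) := ((Int.odd_coe_nat n).2 (Nat.odd_iff.2 hn)).pow
  by_cases h1 : n = 1
  · subst h1; rw [selfSimilarSeq_one]; decide
  · rcases (by omega : n % 4 = 1 ∨ n % 4 = 3) with h | h
    · rwa [selfSimilarSeq_of_mod_four_eq_one h h1]
    · rw [selfSimilarSeq_of_mod_four_eq_three h]
      exact hodd.neg

theorem selfSimilarSeq_injOn (n k : ℕ) (hn : 1 ≤ n) (hk : 1 ≤ k)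
    (h : selfSimilarSeq n = selfSimilarSeq k) : n = k := by
  induction n using Nat.strong_induction_on generalizing k with
  | _ n ih =>
    rcases Nat.even_or_odd' n with ⟨a, rfl | rfl⟩ <;> rcases Nat.even_or_odd' k with ⟨b, rfl | rfl⟩
    · rw [selfSimilarSeq_two_mul, selfSimilarSeq_two_mul] at h
      rw [ih a (by omega) b (by omega) (by omega) (by omega)]
    · have := selfSimilarSeq_odd (n := 2 * b + 1) (by omega)
      rw [← h, selfSimilarSeq_two_mul, Int.odd_iff] at this
      omega
    · have := selfSimilarSeq_odd (n := 2 * a + 1) (by omega)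
      rw [h, selfSimilarSeq_two_mul, Int.odd_iff] at this
      omega
    · exact selfSimilarSeq_injective_of_odd (by omega) (by omega) h

theorem getD_map_range (f : ℕ → ℤ) {N i : ℕ} (h : i < N) :
    ((List.range N).map f).getD i 0 = f i := by
  simp [List.getD_eq_getElem?_getD, h]

theorem squareFreeL_selfSimilarSeq (s N : ℕ) (hs : 1 ≤ s) :
    SquareFreeL ((List.range N).map fun x => selfSimilarSeq (s + x)) := by
  rintro ⟨f, ⟨u, v, huv⟩, a, b, rfl, ha, hab, hiso⟩
  have hlen := congrArg List.length huv
  simp only [List.length_append, List.length_map, List.length_range] at hlen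
  have hget : ∀ i, i < N → (u ++ (a ++ b) ++ v).getD i 0 = selfSimilarSeq (s + i) := fun i hi => by
    rw [huv, getD_map_range _ hi]
  have hfst : ∀ x, x < a.length → a.getD x 0 = selfSimilarSeq (s + u.length + x) := fun x hx => by
    rw [add_assoc, ← hget (u.length + x) (by omega), List.append_assoc,
      List.getD_append_right _ _ _ _ (by omega), List.append_assoc,
      List.getD_append _ _ _ _ (by omega), Nat.add_sub_cancel_left]
  have hsnd : ∀ x, x < a.length → b.getD x 0 = selfSimilarSeq (s + u.length + a.length + x) :=
    fun x hx => by
    rw [show s + u.length + a.length + x = s + (u.length + (a.length + x)) by ring,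
      ← hget _ (by omega), List.append_assoc,
      List.getD_append_right _ _ _ _ (by omega), Nat.add_sub_cancel_left, List.append_assoc,
      List.getD_append_right _ _ _ _ (by omega), Nat.add_sub_cancel_left,
      List.getD_append _ _ _ _ (by omega)]
  refine selfSimilarSeq_not_square a.length ha (s + u.length) (by omega) fun x y hx hy => ?_
  rw [← hfst x hx, ← hfst y hy, ← hsnd x hx, ← hsnd y hy]
  exact hiso x y hx hy

theorem stmt8 (m : ℕ) (hm : 2 ≤ m) :
    ∃ r : List ℤ, r.Nodup ∧ r.length = 2*m - 1 ∧ SquareFreeL r ∧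
      r.getD 1 0 > r.getD 2 0 ∧ r.getD (2*m - 4) 0 > r.getD (2*m - 3) 0 := by
  obtain ⟨s, hs⟩ : ∃ s, (s = 4 ∧ m % 2 = 1) ∨ (s = 5 ∧ m % 2 = 0) := by
    rcases Nat.mod_two_eq_zero_or_one m with h | h
    · exact ⟨5, Or.inr ⟨rfl, h⟩⟩
    · exact ⟨4, Or.inl ⟨rfl, h⟩⟩
  refine ⟨(List.range (2 * m - 1)).map fun x => selfSimilarSeq (s + x), ?_, by simp,
    squareFreeL_selfSimilarSeq s _ (by omega), ?_, ?_⟩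
  · refine List.nodup_range.map fun x y hxy => ?_
    have := selfSimilarSeq_injOn _ _ (by omega) (by omega) hxy
    omega
  · rw [getD_map_range _ (by omega), getD_map_range _ (by omega)]
    exact selfSimilarSeq_succ_lt (n := s + 1) (by omega) (by omega)
  · rw [getD_map_range _ (by omega), getD_map_range _ (by omega),
      show s + (2 * m - 3) = s + (2 * m - 4) + 1 by omega]
    exact selfSimilarSeq_succ_lt (by omega) (by omega)
end

section
/- For any m ≥ 2, there exists a {0, 1, 8m+4, 8m+5}-crucial square-free permutation of length 8m+5. That is, there exists a square-free permutation P of length 8m+5 such that for every i ∈ {0, 1, 8m+4, 8m+5}, every extension of P in position i contains a square. -/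
/-- The factors of length `k` of `g` starting at `s` and at `s + k` are order-isomorphic. -/
def SquareAt (g : ℕ → ℤ) (s k : ℕ) : Prop :=
  ∀ i < k, ∀ j < k, (g (s + i) < g (s + j) ↔ g (s + k + i) < g (s + k + j))

/-- Some pair of positions is ordered in opposite ways by the two consecutive factors
of length `k` of `g` that start at `s`. -/
def Separated {α : Type*} [LT α] (g : ℕ → α) (s k : ℕ) : Prop :=
  ∃ i < k, ∃ j < k, g (s + i) < g (s + j) ∧ g (s + k + j) < g (s + k + i)

/-- All pairs of consecutive factors of equal length at least two within the first `N` terms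
are separated. -/
def NoSquare {α : Type*} [LT α] (N : ℕ) (g : ℕ → α) : Prop :=
  ∀ s k, 2 ≤ k → s + 2 * k ≤ N → Separated g s k

theorem Separated.not_squareAt {g : ℕ → ℤ} {s k : ℕ} (h : Separated g s k) :
    ¬ SquareAt g s k := by
  obtain ⟨i, hi, j, hj, h1, h2⟩ := h
  exact fun hs => lt_asymm ((hs i hi j hj).1 h1) h2

theorem containsSquare_iff (Q : List ℤ) :
    ContainsSquare Q ↔
      ∃ s k, 2 ≤ k ∧ s + 2 * k ≤ Q.length ∧ SquareAt (fun i => Q.getD i 0) s k := by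
  constructor
  · rintro ⟨f, ⟨pre, suf, rfl⟩, a, b, rfl, ha, hab, h⟩
    refine ⟨pre.length, a.length, ha, by simp; omega, fun i hi j hj => ?_⟩
    have left : ∀ i < a.length,
        (pre ++ (a ++ b) ++ suf).getD (pre.length + i) 0 = a.getD i 0 := by
      intro i hi
      simp [List.getD_eq_getElem?_getD, List.getElem?_append, hi]
    have right : ∀ i < a.length,
        (pre ++ (a ++ b) ++ suf).getD (pre.length + a.length + i) 0 = b.getD i 0 := by
      intro i hi
      have hb : i < b.length := hab ▸ hi
      simp [List.getD_eq_getElem?_getD, List.getElem?_append, add_assoc, hb]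
    simp only [left i hi, left j hj, right i hi, right j hj]
    exact h i j hi hj
  · rintro ⟨s, k, hk, hlen, h⟩
    have split : Q = Q.take s ++ ((Q.drop s).take k ++ (Q.drop (s + k)).take k) ++
        Q.drop (s + k + k) := by
      conv_lhs => rw [← List.take_append_drop s Q, ← List.take_append_drop k (Q.drop s),
        List.drop_drop, ← List.take_append_drop k (Q.drop (s + k)), List.drop_drop]
      simp
    refine ⟨_, ⟨_, _, split.symm⟩, _, _, rfl, by simp; omega, by simp; omega, ?_⟩
    intro i j hi hj
    have hi' : i < k := by simp at hi; omega
    have hj' : j < k := by simp at hj; omega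
    simpa [List.getD_eq_getElem?_getD, List.getElem?_take, hi', hj'] using h i hi' j hj'

theorem squareFreeL_of_noSquare {P : List ℤ} (h : NoSquare P.length fun i => P.getD i 0) :
    SquareFreeL P := by
  rw [SquareFreeL, containsSquare_iff]
  rintro ⟨s, k, hk, hlen, hs⟩
  exact (h s k hk hlen).not_squareAt hs

/-- Every way of inserting a new entry at position `c` of `G` creates a square. The entries of
`G` become odd numbers, so that the even numbers represent all possible relative orders. -/
def ForcesSquare (G : List ℕ) (c : ℕ) : Prop :=
  ∀ v ∈ 0 :: G.map (2 * · + 2), ∃ s < G.length + 1, ∃ k < G.length + 1,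
    2 ≤ k ∧ s + 2 * k ≤ G.length + 1 ∧ ∀ i < k, ∀ j < k,
      (((G.map (2 * · + 1)).insertIdx c v).getD (s + i) 0 <
          ((G.map (2 * · + 1)).insertIdx c v).getD (s + j) 0 ↔
        ((G.map (2 * · + 1)).insertIdx c v).getD (s + k + i) 0 <
          ((G.map (2 * · + 1)).insertIdx c v).getD (s + k + j) 0)

instance (G : List ℕ) (c : ℕ) : Decidable (ForcesSquare G c) := by
  unfold ForcesSquare; infer_instance

/-- An integer `x` cuts the values `q` in the same way as some even number cuts the odd numbers
`2 * G i + 1`, where `G` induces the same order as `q`. -/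
theorem exists_insertion_value (G : List ℕ) (q : ℕ → ℤ) (x : ℤ)
    (hq : ∀ i < G.length, ∀ j < G.length, (q i < q j ↔ G.getD i 0 < G.getD j 0))
    (hx : ∀ i < G.length, q i ≠ x) :
    ∃ v ∈ 0 :: G.map (2 * · + 2), ∀ i < G.length,
      (q i < x ↔ 2 * G.getD i 0 + 1 < v) ∧ (x < q i ↔ v < 2 * G.getD i 0 + 1) := by
  by_cases hne : ((Finset.range G.length).filter fun i => q i < x).Nonempty
  · obtain ⟨j, hj, hmax⟩ := Finset.exists_max_image _ (fun i => G.getD i 0) hne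
    simp only [Finset.mem_filter, Finset.mem_range] at hj hmax
    refine ⟨2 * G.getD j 0 + 2, ?_, fun i hi => ?_⟩
    · rw [List.getD_eq_getElem _ _ hj.1]
      exact List.mem_cons_of_mem _ (List.mem_map.2 ⟨_, List.getElem_mem hj.1, rfl⟩)
    · have h1 := hmax i
      have h2 := hq j hj.1 i hi
      have h3 := hx i hi
      have h4 : q i < x ↔ G.getD i 0 ≤ G.getD j 0 :=
        ⟨fun h => h1 ⟨hi, h⟩, fun h => by
          by_contra h5
          have := h2.1 (by have := hj.2; omega)
          omega⟩
      constructor <;> omega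
  · have h : ∀ i < G.length, ¬ q i < x := fun i hi hlt =>
      hne ⟨i, by simp [hi, hlt]⟩
    refine ⟨0, by simp, fun i hi => ?_⟩
    have h1 := h i hi
    have h2 := hx i hi
    constructor <;> omega

theorem containsSquare_of_forcesSquare {P : List ℤ} {G : List ℕ} {o c : ℕ}
    (hG : ForcesSquare G c) (hc : c ≤ G.length) (hlen : o + G.length ≤ P.length)
    (hP : ∀ i < G.length, ∀ j < G.length,
      (P.getD (o + i) 0 < P.getD (o + j) 0 ↔ G.getD i 0 < G.getD j 0))
    {Q : List ℤ} (hQ : ExtL Q P (o + c)) : ContainsSquare Q := by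
  obtain ⟨hnd, hQlen, -, hel, hiso⟩ := hQ
  set old : ℕ → ℕ := fun i => if i < c then i else i + 1 with hold
  have hQold : ∀ i, (Q.eraseIdx (o + c)).getD (o + i) 0 = Q.getD (o + old i) 0 := by
    intro i
    simp only [List.getD_eq_getElem?_getD, List.getElem?_eraseIdx, hold]
    by_cases h : i < c <;> simp [h, add_assoc]
  have hord : ∀ i < G.length, ∀ j < G.length,
      (Q.getD (o + old i) 0 < Q.getD (o + old j) 0 ↔ G.getD i 0 < G.getD j 0) := by
    intro i hi j hj
    rw [← hQold, ← hQold, hiso _ _ (by omega) (by omega), hP i hi j hj]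
  have hx : ∀ i < G.length, Q.getD (o + old i) 0 ≠ Q.getD (o + c) 0 := by
    intro i hi
    have h1 : old i ≤ i + 1 ∧ old i ≠ c := by simp only [hold]; split_ifs <;> omega
    rw [List.getD_eq_getElem _ _ (by omega), List.getD_eq_getElem _ _ (by omega), Ne,
      hnd.getElem_inj_iff]
    omega
  obtain ⟨v, hv, hcut⟩ := exists_insertion_value G (fun i => Q.getD (o + old i) 0) _ hord hx
  obtain ⟨s, -, k, -, hk, hsk, hsq⟩ := hG v hv
  set E := (G.map (2 * · + 1)).insertIdx c v with hE
  have hEc : E.getD c 0 = v := by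
    simp [hE, List.getD_eq_getElem?_getD, List.getElem?_insertIdx, hc]
  have hEold : ∀ i < G.length, E.getD (old i) 0 = 2 * G.getD i 0 + 1 := by
    intro i hi
    simp only [hE, hold, List.getD_eq_getElem?_getD, List.getElem?_insertIdx]
    by_cases h : i < c
    · simp [h, hi]
    · have h1 : ¬ i + 1 < c := by omega
      have h2 : i + 1 ≠ c := by omega
      simp [h, h1, h2, hi]
  have hcover : ∀ a < G.length + 1, a = c ∨ ∃ i < G.length, a = old i := by
    intro a ha
    rcases lt_trichotomy a c with h | h | h
    · exact Or.inr ⟨a, by omega, by simp [hold, h]⟩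
    · exact Or.inl h
    · exact Or.inr ⟨a - 1, by omega, by simp only [hold]; split_ifs <;> omega⟩
  have hcmp : ∀ a < G.length + 1, ∀ b < G.length + 1,
      (Q.getD (o + a) 0 < Q.getD (o + b) 0 ↔ E.getD a 0 < E.getD b 0) := by
    intro a ha b hb
    rcases hcover a ha with rfl | ⟨i, hi, rfl⟩ <;> rcases hcover b hb with rfl | ⟨j, hj, rfl⟩
    · simp
    · rw [hEc, hEold j hj]; exact (hcut j hj).2
    · rw [hEc, hEold i hi]; exact (hcut i hi).1
    · rw [hEold i hi, hEold j hj, hord i hi j hj]; omega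
  refine (containsSquare_iff Q).2 ⟨o + s, k, hk, by omega, fun i hi j hj => ?_⟩
  have h1 := hcmp (s + i) (by omega) (s + j) (by omega)
  have h2 := hcmp (s + k + i) (by omega) (s + k + j) (by omega)
  simp only [← add_assoc] at h1 h2
  exact (h1.trans (hsq i hi j hj)).trans h2.symm

theorem extL_containsSquare_of_ends {P : List ℤ} {G H : List ℕ} {n : ℕ} (hn : P.length = n)
    (hGl : G.length = 15) (hHl : H.length = 15) (hn15 : 15 ≤ n)
    (hG0 : ForcesSquare G 0) (hG1 : ForcesSquare G 1)
    (hH0 : ForcesSquare H 14) (hH1 : ForcesSquare H 15)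
    (hG : ∀ i < 15, ∀ j < 15, (P.getD i 0 < P.getD j 0 ↔ G.getD i 0 < G.getD j 0))
    (hH : ∀ i < 15, ∀ j < 15,
      (P.getD (n - 15 + i) 0 < P.getD (n - 15 + j) 0 ↔ H.getD i 0 < H.getD j 0)) :
    ∀ i ∈ ({0, 1, n - 1, n} : Set ℕ), ∀ Q : List ℤ, ExtL Q P i → ContainsSquare Q := by
  intro i hi Q hQ
  have left : ∀ c ≤ 15, ForcesSquare G c → ExtL Q P c → ContainsSquare Q := fun c hc hF h =>
    containsSquare_of_forcesSquare (P := P) (o := 0) (G := G) hF (by omega)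
      (by omega) (by simpa [hGl] using hG) (by simpa using h)
  have right : ∀ c ≤ 15, ForcesSquare H c → ExtL Q P (n - 15 + c) → ContainsSquare Q :=
    fun c hc hF h => containsSquare_of_forcesSquare (P := P) (o := n - 15) (G := H) hF (by omega)
      (by omega) (by simpa [hHl] using hH) h
  simp only [Set.mem_insert_iff, Set.mem_singleton_iff] at hi
  rcases hi with rfl | rfl | rfl | rfl
  · exact left 0 (by omega) hG0 hQ
  · exact left 1 (by omega) hG1 hQ
  · exact right 14 (by omega) hH0 (by rwa [show n - 15 + 14 = n - 1 by omega])
  · exact right 15 (by omega) hH1 (by rwa [Nat.sub_add_cancel hn15])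

theorem separated_of_mod_four {N : ℕ} {g : ℕ → ℤ}
    (hup : ∀ i, i + 1 < N → i % 4 = 1 ∨ i % 4 = 2 → g i < g (i + 1))
    (hdown : ∀ i, i + 1 < N → i % 4 = 0 ∨ i % 4 = 3 → g (i + 1) < g i)
    {s k : ℕ} (hk : 2 ≤ k) (hk4 : k % 4 ≠ 0) (hs : s + 2 * k ≤ N) : Separated g s k := by
  have key : ∀ d, d + 1 < k →
      ((s + d) % 4 = 1 ∨ (s + d) % 4 = 2 ↔ (s + k + d) % 4 = 0 ∨ (s + k + d) % 4 = 3) →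
      Separated g s k := by
    intro d hd h
    by_cases hc : (s + d) % 4 = 1 ∨ (s + d) % 4 = 2
    · have h1 := hup (s + d) (by omega) hc
      have h2 := hdown (s + k + d) (by omega) (h.1 hc)
      exact ⟨d, by omega, d + 1, hd, h1, h2⟩
    · have h1 := hdown (s + d) (by omega) (by omega)
      have h2 := hup (s + k + d) (by omega) (by omega)
      exact ⟨d + 1, hd, d, by omega, h1, h2⟩
  by_cases h0 : (s + 0) % 4 = 1 ∨ (s + 0) % 4 = 2 ↔ (s + k + 0) % 4 = 0 ∨ (s + k + 0) % 4 = 3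
  · exact key 0 (by omega) h0
  · exact key 1 (by omega) (by omega)

theorem exists_bound (N : ℕ) (f : ℕ → ℤ) : ∃ B : ℤ, (N : ℤ) ≤ B ∧ ∀ i < N, |f i| ≤ B := by
  refine ⟨N + ∑ i ∈ Finset.range N, |f i|,
    le_add_of_nonneg_right (Finset.sum_nonneg fun _ _ => abs_nonneg _), fun i hi => ?_⟩
  have := Finset.single_le_sum (f := fun i => |f i|) (fun _ _ => abs_nonneg _)
    (Finset.mem_range.2 hi)
  omega

/-- Interleave `f` with alternating values below and above its range. -/
def interleave (B : ℤ) (f : ℕ → ℤ) (i : ℕ) : ℤ :=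
  if i % 2 = 0 then f (i / 2) else if i % 4 = 1 then -(B + 1) - i else B + 1 + i

theorem exists_noSquare (N : ℕ) :
    ∃ f : ℕ → ℤ, (∀ i < N, ∀ j < N, f i = f j → i = j) ∧ NoSquare N f := by
  have step : ∀ N, (∃ f : ℕ → ℤ, (∀ i < N, ∀ j < N, f i = f j → i = j) ∧ NoSquare N f) →
      ∃ f : ℕ → ℤ, (∀ i < 2 * N, ∀ j < 2 * N, f i = f j → i = j) ∧ NoSquare (2 * N) f := by
    rintro N ⟨f, hinj, hsq⟩
    obtain ⟨B, hB, hf⟩ := exists_bound N f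
    have even : ∀ i, i % 2 = 0 → interleave B f i = f (i / 2) := fun i h => by
      simp [interleave, h]
    have low : ∀ i, i % 4 = 1 → interleave B f i = -(B + 1) - i := fun i h => by
      simp [interleave, h, show ¬ i % 2 = 0 by omega]
    have high : ∀ i, i % 4 = 3 → interleave B f i = B + 1 + i := fun i h => by
      simp [interleave, h, show ¬ i % 2 = 0 by omega]
    have bound : ∀ i < 2 * N, -B ≤ f (i / 2) ∧ f (i / 2) ≤ B := fun i hi =>
      abs_le.1 (hf _ (by omega))
    have cases_mod : ∀ i : ℕ, i % 2 = 0 ∨ i % 4 = 1 ∨ i % 4 = 3 := by omega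
    refine ⟨interleave B f, fun i hi j hj h => ?_, fun s k hk hs => ?_⟩
    · have hi' := bound i hi
      have hj' := bound j hj
      rcases cases_mod i with h1 | h1 | h1 <;> rcases cases_mod j with h2 | h2 | h2 <;>
        simp only [even, low, high, h1, h2] at h <;> try omega
      have := hinj _ (by omega) _ (by omega) h
      omega
    · by_cases hk4 : k % 4 = 0
      · obtain ⟨t, rfl⟩ : ∃ t, k = 2 * t := ⟨k / 2, by omega⟩
        obtain ⟨i, hi, j, hj, h1, h2⟩ := hsq ((s + 1) / 2) t (by omega) (by omega)
        have e : ∀ a, interleave B f (s + (2 * a + s % 2)) = f ((s + 1) / 2 + a) := fun a => by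
          rw [even _ (by omega)]; congr 1; omega
        have e' : ∀ a, interleave B f (s + 2 * t + (2 * a + s % 2)) = f ((s + 1) / 2 + t + a) :=
          fun a => by rw [even _ (by omega)]; congr 1; omega
        refine ⟨2 * i + s % 2, by omega, 2 * j + s % 2, by omega, ?_, ?_⟩
        · rwa [e, e]
        · rwa [e', e']
      · refine separated_of_mod_four (N := 2 * N) (fun i hi h => ?_) (fun i hi h => ?_) hk hk4 hs
        · have hi' := bound i (by omega)
          have hj' := bound (i + 1) hi
          rcases h with h | h
          · rw [low i h, even (i + 1) (by omega)]; omega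
          · rw [even i (by omega), high (i + 1) (by omega)]; omega
        · have hi' := bound i (by omega)
          have hj' := bound (i + 1) hi
          rcases h with h | h
          · rw [even i (by omega), low (i + 1) (by omega)]; omega
          · rw [high i h, even (i + 1) (by omega)]; omega
  have pow : ∀ r, ∃ f : ℕ → ℤ, (∀ i < 2 ^ r, ∀ j < 2 ^ r, f i = f j → i = j) ∧
      NoSquare (2 ^ r) f := by
    intro r
    induction r with
    | zero => exact ⟨fun _ => 0, by intros; omega, by intro s k hk hs; omega⟩
    | succ r ih => rw [pow_succ']; exact step _ ih
  obtain ⟨f, hinj, hsq⟩ := pow N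
  have hN : N < 2 ^ N := Nat.lt_two_pow_self
  exact ⟨f, fun i hi j hj => hinj i (by omega) j (by omega),
    fun s k hk hs => hsq s k hk (by omega)⟩

/-- Levels of the first 15 entries. -/
def leftLevels : List ℕ := [76, 10, 13, 73, 52, 46, 49, 79, 43, 40, 55, 70, 67, 61, 64]

/-- Levels of the last 15 entries: the reverse complement of `leftLevels`. -/
def rightLevels : List ℕ := leftLevels.reverse.map (120 - ·)

/-- Levels in the middle, by residue modulo 8. -/
def midLevels : List ℕ := [39, 30, 60, 90, 81, 30, 60, 90]

/-- Level of an entry that has `a` entries before it and `b` entries after it, and whose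
position is congruent to `r` modulo 8. -/
def levelAt (a b r : ℕ) : ℕ :=
  if a < 15 then leftLevels.getD a 0
  else if b < 15 then rightLevels.getD (14 - b) 0
  else midLevels.getD (r % 8) 0

/-- Level of the entry in position `i` of the permutation of length `n`. -/
def level (n i : ℕ) : ℕ := levelAt i (n - 1 - i) i

/-- Distances to the two ends (truncated at 15 and 22) and residue modulo 8 of a position in a
permutation of length `8 * m + 5` with `4 ≤ m`. -/
def Admissible (a b r : ℕ) : Prop :=
  (15 ≤ a ∨ r = a % 8) ∧ (22 ≤ b ∨ (b + r) % 8 = 4) ∧ (15 ≤ a ∨ 22 ≤ b)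

instance (a b r : ℕ) : Decidable (Admissible a b r) := by unfold Admissible; infer_instance

/-- The level `j` places after an entry described by `a`, `b` and `r`. -/
def windowLevel (a b r j : ℕ) : ℕ := levelAt (a + j) (b - j) (r + j)

/-- Some pair of indices below `k` is ordered in opposite ways by `g` and `h`. -/
def OppositeOrder (k : ℕ) (g h : ℕ → ℕ) : Prop := ∃ i < k, ∃ j < k, g i < g j ∧ h j < h i

instance (k : ℕ) (g h : ℕ → ℕ) : Decidable (OppositeOrder k g h) := by
  unfold OppositeOrder; infer_instance

/-- The predicate `p` holds for all admissible descriptions of a position. -/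
def ForallAdmissible (p : ℕ → ℕ → ℕ → Prop) : Prop :=
  ∀ a < 16, ∀ b < 23, ∀ r < 8, Admissible a b r → p a b r

instance (p : ℕ → ℕ → ℕ → Prop) [∀ a b r, Decidable (p a b r)] :
    Decidable (ForallAdmissible p) := by
  unfold ForallAdmissible; infer_instance

theorem level_window {n u j : ℕ} (hu : u + j < n) (hj : j < 8) :
    level n (u + j) = windowLevel (min u 15) (min (n - 1 - u) 22) (u % 8) j := by
  unfold level windowLevel levelAt
  rw [show (u % 8 + j) % 8 = (u + j) % 8 by omega]
  by_cases h1 : u + j < 15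
  · rw [if_pos h1, if_pos (by omega), Nat.min_eq_left (by omega)]
  · rw [if_neg h1, if_neg (show ¬ min u 15 + j < 15 by omega)]
    by_cases h2 : n - 1 - (u + j) < 15
    · rw [if_pos h2, if_pos (by omega)]; congr 1; omega
    · rw [if_neg h2, if_neg (by omega)]

theorem ForallAdmissible.apply {p : ℕ → ℕ → ℕ → Prop} (h : ForallAdmissible p) {m u : ℕ}
    (hm : 4 ≤ m) (hu : u < 8 * m + 5) :
    p (min u 15) (min (8 * m + 5 - 1 - u) 22) (u % 8) :=
  h _ (by omega) _ (by omega) _ (by omega) (by unfold Admissible; omega)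

theorem windowLevel_up : ForallAdmissible fun a b r => 1 ≤ b → r % 4 = 1 ∨ r % 4 = 2 →
    windowLevel a b r 0 < windowLevel a b r 1 := by
  decide +kernel

theorem windowLevel_down : ForallAdmissible fun a b r => 1 ≤ b → r % 4 = 0 ∨ r % 4 = 3 →
    windowLevel a b r 1 < windowLevel a b r 0 := by
  decide +kernel

theorem windowLevel_opposite_four : ForallAdmissible fun a b r => 7 ≤ b →
    OppositeOrder 4 (windowLevel a b r) fun i => windowLevel a b r (4 + i) := by
  decide +kernel

theorem windowLevel_opposite_left : ∀ s < 14, ForallAdmissible fun a b r =>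
    7 ≤ b → min (s + 8) 15 ≤ a → r % 4 = s % 4 →
      OppositeOrder 8 (windowLevel s 22 (s % 8)) (windowLevel a b r) := by
  decide +kernel

theorem windowLevel_opposite_right : ∀ d < 21, 7 ≤ d → ForallAdmissible fun a b r =>
    min (d + 8) 22 ≤ b → r % 4 = (28 - d) % 4 →
      OppositeOrder 8 (windowLevel a b r) (windowLevel 15 d ((28 - d) % 8)) := by
  decide +kernel

/-- The permutation: entries are ordered by level, and entries of equal level by `f` if they are
valleys in the middle, and by position otherwise. -/
def crucialEntry (n : ℕ) (B : ℤ) (f : ℕ → ℤ) (i : ℕ) : ℤ :=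
  level n i * (2 * B + 1) + if level n i = 30 then f (i / 4) else i

theorem level_lt_succ {m i : ℕ} (hm : 4 ≤ m) (hi : i + 1 < 8 * m + 5)
    (h : i % 4 = 1 ∨ i % 4 = 2) : level (8 * m + 5) i < level (8 * m + 5) (i + 1) := by
  change level _ (i + 0) < _
  rw [level_window (by omega) (by omega), level_window hi (by omega)]
  exact windowLevel_up.apply hm (by omega) (by omega) (by omega)

theorem level_succ_lt {m i : ℕ} (hm : 4 ≤ m) (hi : i + 1 < 8 * m + 5)
    (h : i % 4 = 0 ∨ i % 4 = 3) : level (8 * m + 5) (i + 1) < level (8 * m + 5) i := by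
  change _ < level _ (i + 0)
  rw [level_window hi (by omega), level_window (by omega) (by omega)]
  exact windowLevel_down.apply hm (by omega) (by omega) (by omega)

theorem level_separated {m s t : ℕ} (hm : 4 ≤ m) (ht : 1 ≤ t) (hs : s + 8 * t ≤ 8 * m + 5)
    (h : t = 1 ∨ s < 14 ∨ 8 * m + 5 < s + 8 * t + 14) :
    Separated (level (8 * m + 5)) s (4 * t) := by
  rcases Nat.lt_or_ge t 2 with ht1 | ht2
  · obtain rfl : t = 1 := by omega
    obtain ⟨i, hi, j, hj, h1, h2⟩ := windowLevel_opposite_four.apply hm (show s < _ by omega)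
      (by omega)
    refine ⟨i, by omega, j, by omega, ?_, ?_⟩
    · rwa [level_window (by omega) (by omega), level_window (by omega) (by omega)]
    · rwa [add_assoc, add_assoc, level_window (by omega) (by omega),
        level_window (by omega) (by omega)]
  · rcases Nat.lt_or_ge s 14 with hs14 | hs14
    · obtain ⟨i, hi, j, hj, h1, h2⟩ := (windowLevel_opposite_left s hs14).apply hm
        (show s + 4 * t < _ by omega) (by omega) (by omega) (by omega)
      refine ⟨i, by omega, j, by omega, ?_, ?_⟩
      · rw [level_window (by omega) (by omega), level_window (by omega) (by omega)]
        rwa [Nat.min_eq_left (by omega), Nat.min_eq_right (by omega)]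
      · rwa [level_window (by omega) (by omega), level_window (by omega) (by omega)]
    · obtain ⟨i, hi, j, hj, h1, h2⟩ := (windowLevel_opposite_right (8 * m + 12 - s - 8 * t)
        (by omega) (by omega)).apply hm (show s + 4 * t - 8 < _ by omega) (by omega) (by omega)
      refine ⟨4 * t - 8 + i, by omega, 4 * t - 8 + j, by omega, ?_, ?_⟩
      · have e : ∀ a, s + (4 * t - 8 + a) = s + 4 * t - 8 + a := by omega
        rwa [e, e, level_window (by omega) (by omega), level_window (by omega) (by omega)]
      · have e : ∀ a, s + 4 * t + (4 * t - 8 + a) = s + 8 * t - 8 + a := by omega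
        rw [e, e, level_window (by omega) (by omega), level_window (by omega) (by omega)]
        rwa [Nat.min_eq_right (show 15 ≤ s + 8 * t - 8 by omega),
          Nat.min_eq_left (by omega),
          show 8 * m + 5 - 1 - (s + 8 * t - 8) = 8 * m + 12 - s - 8 * t by omega,
          show (s + 8 * t - 8) % 8 = (28 - (8 * m + 12 - s - 8 * t)) % 8 by omega]

theorem level_valley {n i : ℕ} (h1 : 15 ≤ i) (h2 : i + 15 < n) (h3 : i % 4 = 1) :
    level n i = 30 := by
  rw [level, levelAt, if_neg (by omega), if_neg (by omega)]
  have : i % 8 = 1 ∨ i % 8 = 5 := by omega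
  rcases this with h | h <;> rw [h] <;> rfl

theorem windowLevel_eq_thirty : ForallAdmissible fun a b r =>
    windowLevel a b r 0 = 30 → r % 4 = 1 := by
  decide +kernel

theorem mod_four_of_level_eq_thirty {m i : ℕ} (hm : 4 ≤ m) (hi : i < 8 * m + 5)
    (h : level (8 * m + 5) i = 30) : i % 4 = 1 := by
  rw [← add_zero i, level_window hi (by omega)] at h
  have := windowLevel_eq_thirty.apply hm hi h
  omega

section Entries

variable {n : ℕ} {B : ℤ} {f : ℕ → ℤ}

theorem crucialEntry_lt (hB : (n : ℤ) ≤ B) (hf : ∀ i < n, |f i| ≤ B) {i j : ℕ} (hi : i < n)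
    (hj : j < n) (h : level n i < level n j) : crucialEntry n B f i < crucialEntry n B f j := by
  have bound : ∀ i < n, -B ≤ (if level n i = 30 then f (i / 4) else i) ∧
      (if level n i = 30 then f (i / 4) else i) ≤ B := by
    intro i hi
    split_ifs
    · exact abs_le.1 (hf _ (by omega))
    · omega
  have hi' := bound i hi
  have hj' := bound j hj
  unfold crucialEntry
  have h1 : (level n i : ℤ) + 1 ≤ level n j := by exact_mod_cast h
  nlinarith

theorem crucialEntry_lt_iff (hB : (n : ℤ) ≤ B) (hf : ∀ i < n, |f i| ≤ B) {i j : ℕ} (hi : i < n)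
    (hj : j < n) (h : level n i = level n j → i = j) :
    crucialEntry n B f i < crucialEntry n B f j ↔ level n i < level n j := by
  refine ⟨fun hlt => ?_, crucialEntry_lt hB hf hi hj⟩
  rcases lt_trichotomy (level n i) (level n j) with h1 | h1 | h1
  · exact h1
  · rw [h h1] at hlt; exact absurd hlt (lt_irrefl _)
  · exact absurd hlt (crucialEntry_lt hB hf hj hi h1).not_gt

theorem Separated.crucialEntry (hB : (n : ℤ) ≤ B) (hf : ∀ i < n, |f i| ≤ B) {s k : ℕ}
    (hs : s + 2 * k ≤ n) (h : Separated (level n) s k) : Separated (crucialEntry n B f) s k := by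
  obtain ⟨i, hi, j, hj, h1, h2⟩ := h
  exact ⟨i, hi, j, hj, crucialEntry_lt hB hf (by omega) (by omega) h1,
    crucialEntry_lt hB hf (by omega) (by omega) h2⟩

end Entries

theorem crucialEntry_inj {m : ℕ} {B : ℤ} {f : ℕ → ℤ} (hm : 4 ≤ m)
    (hB : ((8 * m + 5 : ℕ) : ℤ) ≤ B) (hf : ∀ i < 8 * m + 5, |f i| ≤ B)
    (hinj : ∀ i < 8 * m + 5, ∀ j < 8 * m + 5, f i = f j → i = j) {i j : ℕ}
    (hi : i < 8 * m + 5) (hj : j < 8 * m + 5)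
    (h : crucialEntry (8 * m + 5) B f i = crucialEntry (8 * m + 5) B f j) : i = j := by
  have hlev : level (8 * m + 5) i = level (8 * m + 5) j := by
    rcases lt_trichotomy (level (8 * m + 5) i) (level (8 * m + 5) j) with h1 | h1 | h1
    · exact absurd h (crucialEntry_lt hB hf hi hj h1).ne
    · exact h1
    · exact absurd h (crucialEntry_lt hB hf hj hi h1).ne'
  rw [crucialEntry, crucialEntry, ← hlev, add_right_inj] at h
  by_cases h30 : level (8 * m + 5) i = 30
  · rw [if_pos h30, if_pos h30] at h
    have h1 := hinj _ (by omega) _ (by omega) h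
    have h2 := mod_four_of_level_eq_thirty hm hi h30
    have h3 := mod_four_of_level_eq_thirty hm hj (hlev ▸ h30)
    omega
  · rw [if_neg h30, if_neg h30] at h
    exact_mod_cast h

theorem crucialEntry_noSquare {m : ℕ} {B : ℤ} {f : ℕ → ℤ} (hm : 4 ≤ m)
    (hB : ((8 * m + 5 : ℕ) : ℤ) ≤ B) (hf : ∀ i < 8 * m + 5, |f i| ≤ B)
    (hsq : NoSquare (8 * m + 5) f) : NoSquare (8 * m + 5) (crucialEntry (8 * m + 5) B f) := by
  intro s k hk hs
  by_cases hk4 : k % 4 = 0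
  · obtain ⟨t, rfl⟩ : ∃ t, k = 4 * t := ⟨k / 4, by omega⟩
    by_cases hend : t = 1 ∨ s < 14 ∨ 8 * m + 5 < s + 8 * t + 14
    · exact (level_separated hm (by omega) (by omega) hend).crucialEntry hB hf hs
    · obtain ⟨i, hi, j, hj, h1, h2⟩ := hsq ((s + 2) / 4) t (by omega) (by omega)
      have entry : ∀ a, s ≤ 4 * a + 1 → 4 * a + 1 < s + 8 * t →
          crucialEntry (8 * m + 5) B f (4 * a + 1) = 30 * (2 * B + 1) + f a := by
        intro a h3 h4
        rw [crucialEntry, level_valley (by omega) (by omega) (by omega), if_pos rfl,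
          show (4 * a + 1) / 4 = a by omega]
        rfl
      have first : ∀ a, s + (4 * ((s + 2) / 4 + a) + 1 - s) = 4 * ((s + 2) / 4 + a) + 1 := by
        omega
      have second : ∀ a, s + 4 * t + (4 * ((s + 2) / 4 + a) + 1 - s) =
          4 * ((s + 2) / 4 + t + a) + 1 := by
        omega
      refine ⟨4 * ((s + 2) / 4 + i) + 1 - s, by omega, 4 * ((s + 2) / 4 + j) + 1 - s, by omega,
        ?_, ?_⟩
      · rw [first, first, entry _ (by omega) (by omega), entry _ (by omega) (by omega)]
        omega
      · rw [second, second, entry _ (by omega) (by omega), entry _ (by omega) (by omega)]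
        omega
  · refine separated_of_mod_four (N := 8 * m + 5) (fun i hi h => ?_) (fun i hi h => ?_) hk hk4 hs
    · exact crucialEntry_lt hB hf (by omega) hi (level_lt_succ hm hi h)
    · exact crucialEntry_lt hB hf hi (by omega) (level_succ_lt hm hi h)

theorem leftLevels_inj : ∀ i < 15, ∀ j < 15,
    leftLevels.getD i 0 = leftLevels.getD j 0 → i = j := by
  decide +kernel

theorem rightLevels_inj : ∀ i < 15, ∀ j < 15,
    rightLevels.getD i 0 = rightLevels.getD j 0 → i = j := by
  decide +kernel

theorem exists_crucial_of_four_le {m : ℕ} (hm : 4 ≤ m) :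
    ∃ P : List ℤ, P.Nodup ∧ P.length = 8 * m + 5 ∧ SquareFreeL P ∧
      ∀ i ∈ ({0, 1, 8 * m + 4, 8 * m + 5} : Set ℕ), ∀ Q : List ℤ,
        ExtL Q P i → ContainsSquare Q := by
  obtain ⟨f, hinj, hsq⟩ := exists_noSquare (8 * m + 5)
  obtain ⟨B, hB, hf⟩ := exists_bound (8 * m + 5) f
  set P := (List.range (8 * m + 5)).map (crucialEntry (8 * m + 5) B f) with hP
  have hlen : P.length = 8 * m + 5 := by simp [hP]
  have hget : ∀ i < 8 * m + 5, P.getD i 0 = crucialEntry (8 * m + 5) B f i := by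
    intro i hi
    simp [hP, List.getD_eq_getElem?_getD, hi]
  have hleft : ∀ i < 15, level (8 * m + 5) i = leftLevels.getD i 0 := fun i hi => by
    rw [level, levelAt, if_pos hi]
  have hright : ∀ i < 15, level (8 * m + 5) (8 * m + 5 - 15 + i) = rightLevels.getD i 0 :=
    fun i hi => by
      rw [level, levelAt, if_neg (by omega), if_pos (by omega)]
      congr 1; omega
  refine ⟨P, ?_, hlen, squareFreeL_of_noSquare ?_, ?_⟩
  · exact List.Nodup.map_on (fun i hi j hj h => crucialEntry_inj hm hB hf hinj
      (List.mem_range.1 hi) (List.mem_range.1 hj) h) List.nodup_range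
  · intro s k hk hs
    rw [hlen] at hs
    obtain ⟨i, hi, j, hj, h1, h2⟩ := crucialEntry_noSquare hm hB hf hsq s k hk hs
    refine ⟨i, hi, j, hj, ?_, ?_⟩
    all_goals beta_reduce
    · rwa [hget _ (by omega), hget _ (by omega)]
    · rwa [hget _ (by omega), hget _ (by omega)]
  · refine extL_containsSquare_of_ends (G := leftLevels) (H := rightLevels) hlen rfl rfl (by omega)
      (by decide +kernel) (by decide +kernel) (by decide +kernel) (by decide +kernel) ?_ ?_
    · intro i hi j hj
      rw [hget _ (by omega), hget _ (by omega), crucialEntry_lt_iff hB hf (by omega) (by omega),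
        hleft i hi, hleft j hj]
      rw [hleft i hi, hleft j hj]
      exact leftLevels_inj i hi j hj
    · intro i hi j hj
      rw [hget _ (by omega), hget _ (by omega), crucialEntry_lt_iff hB hf (by omega) (by omega),
        hright i hi, hright j hj]
      rw [hright i hi, hright j hj]
      intro h
      rw [rightLevels_inj i hi j hj h]

theorem exists_crucial_of_list (L : List ℕ) (hL : 15 ≤ L.length) (hnd : L.Nodup)
    (hsq : ∀ s ≤ L.length, ∀ k ≤ L.length, 2 ≤ k → s + 2 * k ≤ L.length →
      Separated (fun i => L.getD i 0) s k)
    (hl0 : ForcesSquare (L.take 15) 0) (hl1 : ForcesSquare (L.take 15) 1)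
    (hr0 : ForcesSquare (L.drop (L.length - 15)) 14)
    (hr1 : ForcesSquare (L.drop (L.length - 15)) 15) :
    ∃ P : List ℤ, P.Nodup ∧ P.length = L.length ∧ SquareFreeL P ∧
      ∀ i ∈ ({0, 1, L.length - 1, L.length} : Set ℕ), ∀ Q : List ℤ,
        ExtL Q P i → ContainsSquare Q := by
  have hget : ∀ i < L.length, (L.map (fun a : ℕ => (a : ℤ))).getD i 0 = (L.getD i 0 : ℕ) := by
    intro i hi
    simp [List.getD_eq_getElem?_getD, hi]
  refine ⟨L.map (fun a : ℕ => (a : ℤ)), hnd.map Nat.cast_injective, by simp,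
    squareFreeL_of_noSquare ?_, ?_⟩
  · intro s k hk hs
    rw [List.length_map] at hs
    obtain ⟨i, hi, j, hj, h1, h2⟩ := hsq s (by omega) k (by omega) hk hs
    refine ⟨i, hi, j, hj, ?_, ?_⟩
    all_goals beta_reduce
    · rw [hget _ (by omega), hget _ (by omega)]; exact_mod_cast h1
    · rw [hget _ (by omega), hget _ (by omega)]; exact_mod_cast h2
  · refine extL_containsSquare_of_ends (by simp) (by simp [hL]) (by simp; omega) hL
      hl0 hl1 hr0 hr1 ?_ ?_
    · intro i hi j hj
      rw [hget _ (by omega), hget _ (by omega)]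
      simp [List.getD_eq_getElem?_getD, hi, hj]
    · intro i hi j hj
      rw [hget _ (by omega), hget _ (by omega)]
      simp [List.getD_eq_getElem?_getD]

instance (g : ℕ → ℕ) (s k : ℕ) : Decidable (Separated g s k) := by
  unfold Separated; infer_instance

/-- A crucial permutation of length 21. -/
def shortCrucial : List ℕ :=
  [19, 1, 4, 18, 17, 0, 16, 20, 10, 7, 11, 15, 14, 5, 12, 13, 6, 3, 8, 9, 2]

/-- A crucial permutation of length 29. -/
def mediumCrucial : List ℕ :=
  [27, 20, 21, 26, 25, 23, 24, 28, 1, 0, 2, 22, 19, 11, 17, 18, 10, 3, 12, 16, 15, 9, 13, 14,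
    6, 4, 7, 8, 5]

theorem stmt9 (m : ℕ) (hm : 2 ≤ m) :
    ∃ P : List ℤ, P.Nodup ∧ P.length = 8*m + 5 ∧ SquareFreeL P ∧
      ∀ i ∈ ({0, 1, 8*m + 4, 8*m + 5} : Set ℕ), ∀ Q : List ℤ,
        ExtL Q P i → ContainsSquare Q := by
  obtain rfl | rfl | hm4 : m = 2 ∨ m = 3 ∨ 4 ≤ m := by omega
  · exact exists_crucial_of_list shortCrucial (by decide +kernel) (by decide +kernel)
      (by decide +kernel) (by decide +kernel) (by decide +kernel) (by decide +kernel)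
      (by decide +kernel)
  · exact exists_crucial_of_list mediumCrucial (by decide +kernel) (by decide +kernel)
      (by decide +kernel) (by decide +kernel) (by decide +kernel) (by decide +kernel)
      (by decide +kernel)
  · exact exists_crucial_of_four_le hm4
end

section
/- The permutation E₂ = 1,16,15,2,9,17,12,3,14,18,11,4,8,19,10,5,13,20,7,6,21 of length 21 is square-free and is {0,1,20,21}-crucial: for every i ∈ {0,1,20,21}, every extension of E₂ in position i contains a square. -/
def E2 : List ℤ :=
  [1, 16, 15, 2, 9, 17, 12, 3, 14, 18, 11, 4, 8, 19, 10, 5, 13, 20, 7, 6, 21]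

/-- The factors of length `l` starting at `s` and at `s + l` exist and form a square. -/
def HasSquareAt (p : List ℤ) (s l : ℕ) : Prop :=
  2 ≤ l ∧ s + 2 * l ≤ p.length ∧ ∀ i < l, ∀ j < l,
    (p.getD (s + i) 0 < p.getD (s + j) 0 ↔ p.getD (s + l + i) 0 < p.getD (s + l + j) 0)

instance (p : List ℤ) (s l : ℕ) : Decidable (HasSquareAt p s l) := by
  unfold HasSquareAt
  infer_instance

theorem HasSquareAt.containsSquare {p : List ℤ} {s l : ℕ} (h : HasSquareAt p s l) :
    ContainsSquare p := by
  obtain ⟨hl, hlen, h⟩ := h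
  refine ⟨(p.drop s).take l ++ (p.drop (s + l)).take l, ?_, _, _, rfl, ?_, ?_, ?_⟩
  · rw [← List.drop_drop, ← List.take_add]
    exact (List.take_prefix _ _).isInfix.trans (List.drop_suffix _ _).isInfix
  · simp; omega
  · simp; omega
  · intro i j hi hj
    simp only [List.length_take, List.length_drop, lt_min_iff] at hi hj
    have := h i hi.1 j hj.1
    simpa [List.getD_eq_getElem?_getD, List.getElem?_take, hi.1, hj.1] using this

theorem containsSquare_iff_exists_hasSquareAt (p : List ℤ) :
    ContainsSquare p ↔ ∃ s < p.length, ∃ l < p.length, HasSquareAt p s l := by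
  constructor
  · rintro ⟨f, ⟨u, w, rfl⟩, a, b, rfl, ha, hab, h⟩
    refine ⟨u.length, by simp; omega, a.length, by simp; omega, ha, by simp; omega, ?_⟩
    intro i hi j hj
    have left : ∀ k < a.length, (u ++ (a ++ b) ++ w).getD (u.length + k) 0 = a.getD k 0 := by
      intro k hk
      rw [List.append_assoc, List.append_assoc, List.getD_append_right _ _ _ _ (by omega),
        Nat.add_sub_cancel_left, List.getD_append _ _ _ _ hk]
    have right : ∀ k < a.length,
        (u ++ (a ++ b) ++ w).getD (u.length + a.length + k) 0 = b.getD k 0 := by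
      intro k hk
      rw [List.append_assoc, List.append_assoc, List.getD_append_right _ _ _ _ (by omega),
        List.getD_append_right _ _ _ _ (by omega), List.getD_append _ _ _ _ (by omega)]
      congr 1
      omega
    rw [left i hi, left j hj, right i hi, right j hj]
    exact h i j hi hj
  · rintro ⟨s, -, l, -, h⟩
    exact h.containsSquare

theorem OrdIso.containsSquare {p q : List ℤ} (h : OrdIso p q) (hq : ContainsSquare q) :
    ContainsSquare p := by
  obtain ⟨hlen, h⟩ := h
  rw [containsSquare_iff_exists_hasSquareAt] at hq ⊢
  obtain ⟨s, hs, l, hl, hl2, hsl, hsq⟩ := hq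
  refine ⟨s, by omega, l, by omega, hl2, by omega, fun i hi j hj => ?_⟩
  rw [h _ _ (by omega) (by omega), h _ _ (by omega) (by omega)]
  exact hsq i hi j hj

/-- An extension of a sequence of positive integers with entries at most `N` is order-isomorphic
to one obtained by inserting an odd number `2 * k + 1`, `k ≤ N`, into the doubled sequence. -/
theorem ExtL.exists_ordIso {Q P : List ℤ} {i : ℕ} (h : ExtL Q P i) (N : ℕ)
    (hP : ∀ j < P.length, 1 ≤ P.getD j 0 ∧ P.getD j 0 ≤ N) :
    ∃ k < N + 1, OrdIso Q ((P.map (2 * ·)).insertIdx i (2 * (k : ℤ) + 1)) := by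
  obtain ⟨hnd, hlen, hi, hl', hiso⟩ := h
  have hl : (Q.eraseIdx i).length = P.length := hl'
  set v := Q.getD i 0 with hv
  -- the rank of `v` among the remaining symbols
  obtain ⟨k, hkN, hk⟩ : ∃ k < N + 1, ∀ j < P.length,
      ((Q.eraseIdx i).getD j 0 < v ↔ P.getD j 0 ≤ (k : ℤ)) := by
    by_cases hne : ∃ j < P.length, (Q.eraseIdx i).getD j 0 < v
    · obtain ⟨m, hm, hmax⟩ := Finset.exists_max_image
        ((Finset.range P.length).filter fun j => (Q.eraseIdx i).getD j 0 < v)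
        (fun j => P.getD j 0) (by
          obtain ⟨j, hj⟩ := hne
          exact ⟨j, by simpa using hj⟩)
      simp only [Finset.mem_filter, Finset.mem_range] at hm hmax
      have hPm := hP m hm.1
      refine ⟨(P.getD m 0).toNat, by omega, fun j hj => ?_⟩
      rw [Int.toNat_of_nonneg (by omega)]
      refine ⟨fun hjv => hmax j ⟨hj, hjv⟩, fun hjm => ?_⟩
      have := hiso m j (by omega) (by omega)
      have h1 : ¬ (Q.eraseIdx i).getD m 0 < (Q.eraseIdx i).getD j 0 := by
        rw [this]; omega
      omega
    · refine ⟨0, by omega, fun j hj => ?_⟩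
      have := hP j hj
      refine ⟨fun hjv => (hne ⟨j, hj, hjv⟩).elim, fun hj0 => ?_⟩
      push_cast at hj0
      omega
  have hne : ∀ j < P.length, (Q.eraseIdx i).getD j 0 ≠ v := by
    intro j hj he
    rw [List.getD_eq_getElem _ _ (by omega), hv, List.getD_eq_getElem _ _ (by omega),
      List.getElem_eraseIdx] at he
    split at he
    · have := (hnd.getElem_inj_iff).1 he
      omega
    · have := (hnd.getElem_inj_iff).1 he
      omega
  refine ⟨k, hkN, ?_, ?_⟩
  · rw [List.length_insertIdx]
    simp [hi, hlen]
  -- every index is either the inserted one or comes from an index of `P`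
  have key : ∀ a < Q.length,
      (Q.getD a 0 = v ∧
        ((P.map (2 * ·)).insertIdx i (2 * (k : ℤ) + 1)).getD a 0 = 2 * (k : ℤ) + 1) ∨
      ∃ j < P.length, Q.getD a 0 = (Q.eraseIdx i).getD j 0 ∧
        ((P.map (2 * ·)).insertIdx i (2 * (k : ℤ) + 1)).getD a 0 = 2 * P.getD j 0 := by
    intro a ha
    rcases lt_trichotomy a i with hai | rfl | hai
    · refine Or.inr ⟨a, by omega, ?_, ?_⟩
      · simp [List.getD_eq_getElem?_getD, List.getElem?_eraseIdx, hai]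
      · rw [List.getD_eq_getElem?_getD, List.getElem?_insertIdx_of_lt hai,
          List.getD_eq_getElem _ _ (show a < P.length by omega)]
        simp [show a < P.length by omega]
    · refine Or.inl ⟨rfl, ?_⟩
      simp [List.getD_eq_getElem?_getD, List.getElem?_insertIdx_self, hi]
    · obtain ⟨b, rfl⟩ : ∃ b, a = b + 1 := ⟨a - 1, by omega⟩
      refine Or.inr ⟨b, by omega, ?_, ?_⟩
      · simp [List.getD_eq_getElem?_getD, List.getElem?_eraseIdx, show ¬ b < i by omega]
      · rw [List.getD_eq_getElem?_getD, List.getElem?_insertIdx_of_gt hai,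
          List.getD_eq_getElem _ _ (show b < P.length by omega)]
        simp [show b < P.length by omega]
  intro a b ha hb
  rcases key a ha with ⟨ha1, ha2⟩ | ⟨j, hj, ha1, ha2⟩ <;>
    rcases key b hb with ⟨hb1, hb2⟩ | ⟨m, hm, hb1, hb2⟩ <;> rw [ha1, ha2, hb1, hb2]
  · simp
  · have h1 := hk m hm
    have h2 := hne m hm
    omega
  · have h1 := hk j hj
    omega
  · have h1 := hiso j m (by omega) (by omega)
    omega

theorem squareFreeL_E2 : SquareFreeL E2 := by
  rw [SquareFreeL, containsSquare_iff_exists_hasSquareAt]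
  decide +kernel

theorem exists_hasSquareAt_insertIdx_E2 :
    ∀ i ∈ [0, 1, 20, 21], ∀ k < 22,
      ∃ w ∈ [(0, 2), (18, 2), (0, 4), (14, 4), (1, 2), (17, 2), (0, 8), (5, 8)],
        HasSquareAt ((E2.map (2 * ·)).insertIdx i (2 * ((k : ℕ) : ℤ) + 1)) w.1 w.2 := by
  decide +kernel

theorem stmt10 :
    SquareFreeL E2 ∧
    ∀ i ∈ ({0, 1, 20, 21} : Set ℕ), ∀ Q : List ℤ,
      ExtL Q E2 i → ContainsSquare Q := by
  refine ⟨squareFreeL_E2, fun i hi Q hQ => ?_⟩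
  obtain ⟨k, hk, hiso⟩ := hQ.exists_ordIso 21 (by decide +kernel)
  obtain ⟨w, -, hw⟩ := exists_hasSquareAt_insertIdx_E2 i (by simpa using hi) k hk
  exact hiso.containsSquare hw.containsSquare
end
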